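/- Let k be an algebraically closed field of characteristic zero, R = k[[x₁,…,x_p]] the ring of formal power series in p variables with maximal ideal 𝔪, m ≤ n, and A ∈ Mat(m,n;𝔪). Suppose the support of coker(A) is the origin, i.e. there exists N ∈ ℕ with 𝔪^N ⊆ I_m(A). Then there exist U ∈ GL(m,R) and V ∈ GL(n,R) such that every entry of U·A·V is a polynomial, i.e. lies in the image of the polynomial ring k[x₁,…,x_p] inside k[[x₁,…,x_p]]. -/

import Mathlib

open IsLocalRing

/-- The Fitting ideal `I_r(A)`: the ideal generated by all `r × r` minors of `A`. -/
def fittingIdeal {R : Type*} [CommRing R] {m n : ℕ} (r : ℕ)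
    (A : Matrix (Fin m) (Fin n) R) : Ideal R :=
  Ideal.span { d : R | ∃ (f : Fin r → Fin m) (g : Fin r → Fin n),
    Function.Injective f ∧ Function.Injective g ∧ d = (A.submatrix f g).det }

namespace MvPowerSeries

/-- A power series in finitely many variables without terms of degree `< N` lies in the `N`-th power
of any ideal containing the variables. -/
theorem mem_pow_of_coeff_eq_zero {σ R : Type*} [Fintype σ] [CommRing R]
    {I : Ideal (MvPowerSeries σ R)} (hI : ∀ i, X i ∈ I) {N : ℕ} {f : MvPowerSeries σ R}
    (hf : ∀ d : σ →₀ ℕ, d.degree < N → coeff d f = 0) : f ∈ I ^ N := by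
  classical
  induction N generalizing f with
  | zero => simp
  | succ N ih =>
    have hex : ∀ d : σ →₀ ℕ, d ≠ 0 → ∃ i, d i ≠ 0 := fun d hd => by
      simpa [Finsupp.ext_iff] using hd
    choose c hc using hex
    let g : σ → MvPowerSeries σ R := fun i e =>
      if c (e + Finsupp.single i 1) (by simp) = i then coeff (e + Finsupp.single i 1) f else 0
    have hg : ∀ i e, coeff e (g i) =
        if c (e + Finsupp.single i 1) (by simp) = i then coeff (e + Finsupp.single i 1) f else 0 :=
      fun _ _ => rfl
    have hfg : f = ∑ i, X i * g i := by
      ext d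
      simp only [map_sum, X, coeff_monomial_mul, one_mul]
      by_cases hd : d = 0
      · subst hd
        rw [hf 0 (by simp), Finset.sum_eq_zero]
        intro i _
        simp
      · rw [Finset.sum_eq_single (c d hd)]
        · have hle : Finsupp.single (c d hd) 1 ≤ d := by
            simpa [Nat.one_le_iff_ne_zero] using hc d hd
          simp [hle, hg, tsub_add_cancel_of_le hle]
        · intro i _ hi
          split_ifs with hle
          · simp [hg, tsub_add_cancel_of_le hle, hi.symm]
          · rfl
        · simp
    rw [hfg, pow_succ']
    refine Ideal.sum_mem _ fun i _ => Ideal.mul_mem_mul (hI i) (ih fun d hd => ?_)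
    rw [hg, hf _ (by simpa using hd), ite_self]

end MvPowerSeries

section

variable {R : Type*} [CommRing R] {m n : ℕ} {A : Matrix (Fin m) (Fin n) R}

theorem exists_mul_eq_smul_one_of_mem_fittingIdeal {r : R} (hr : r ∈ fittingIdeal m A) :
    ∃ C : Matrix (Fin n) (Fin m) R, A * C = r • 1 := by
  induction hr using Submodule.span_induction with
  | zero => exact ⟨0, by simp⟩
  | add x y _ _ hx hy =>
    obtain ⟨C, hC⟩ := hx
    obtain ⟨D, hD⟩ := hy
    exact ⟨C + D, by rw [Matrix.mul_add, hC, hD, add_smul]⟩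
  | smul a x _ hx =>
    obtain ⟨C, hC⟩ := hx
    exact ⟨a • C, by rw [Matrix.mul_smul, hC, smul_assoc]⟩
  | mem d hd =>
    obtain ⟨f, g, hf, -, rfl⟩ := hd
    let σ : Fin m ≃ Fin m := Equiv.ofBijective f hf.bijective_of_finite
    refine ⟨(1 : Matrix (Fin n) (Fin n) R).submatrix id g *
      (A.submatrix f g).adjugate.submatrix id σ.symm, ?_⟩
    have hA : A * (1 : Matrix (Fin n) (Fin n) R).submatrix id g =
        (A.submatrix f g).submatrix σ.symm id := by
      ext i j
      simp [Matrix.mul_apply, Matrix.one_apply, show f (σ.symm i) = i from σ.apply_symm_apply i]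
    rw [← Matrix.mul_assoc, hA, ← Matrix.submatrix_mul _ _ _ _ _ Function.bijective_id,
      Matrix.mul_adjugate]
    ext i j
    simp [Matrix.one_apply]

theorem exists_mul_eq_of_mem_mul_fittingIdeal {I : Ideal R} {B : Matrix (Fin m) (Fin n) R}
    (hB : ∀ i j, B i j ∈ I * fittingIdeal m A) :
    ∃ C : Matrix (Fin n) (Fin n) R, (∀ i j, C i j ∈ I) ∧ A * C = B := by
  have key : ∀ r ∈ I * fittingIdeal m A,
      ∃ C : Matrix (Fin n) (Fin m) R, (∀ i j, C i j ∈ I) ∧ A * C = r • 1 := by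
    intro r hr
    induction hr using Submodule.mul_induction_on' with
    | mem_mul_mem a ha d hd =>
      obtain ⟨C, hC⟩ := exists_mul_eq_smul_one_of_mem_fittingIdeal hd
      exact ⟨a • C, fun i j => I.mul_mem_right _ ha, by rw [Matrix.mul_smul, hC, smul_smul]⟩
    | add x _ y _ hx hy =>
      obtain ⟨C, hCI, hC⟩ := hx
      obtain ⟨D, hDI, hD⟩ := hy
      exact ⟨C + D, fun i j => I.add_mem (hCI i j) (hDI i j), by rw [Matrix.mul_add, hC, hD, add_smul]⟩
  choose C hCI hC using fun i j => key _ (hB i j)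
  refine ⟨∑ i, ∑ j, C i j * Matrix.single i j (1 : R), fun k l => ?_, ?_⟩
  · simp only [Matrix.sum_apply, Matrix.mul_apply]
    exact I.sum_mem fun i _ => I.sum_mem fun j _ => I.sum_mem fun s _ =>
      I.mul_mem_right _ (hCI i j k s)
  · simp only [Matrix.mul_sum, ← Matrix.mul_assoc, hC]
    conv_rhs => rw [Matrix.matrix_eq_sum_single B]
    simp

end

theorem Matrix.isUnit_one_add_of_mem_maximalIdeal {R ι : Type*} [CommRing R] [IsLocalRing R]
    [Fintype ι] [DecidableEq ι] {C : Matrix ι ι R} (hC : ∀ i j, C i j ∈ maximalIdeal R) :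
    IsUnit (1 + C) := by
  rw [Matrix.isUnit_iff_isUnit_det, ← residue_ne_zero_iff_isUnit, RingHom.map_det]
  have h : (residue R).mapMatrix C = 0 := by
    ext i j
    simpa using hC i j
  simp [map_add, h]

/-- Over `R = k[[x₁,…,x_p]]` with `k` algebraically closed of
characteristic zero, if `m ≤ n` and `𝔪^N ⊆ I_m(A)` for some `N` (i.e. `coker A`
is supported at the origin), then `A` is `G_{lr}`-equivalent to a matrix of
polynomials. -/
theorem algebraization_of_finite_support
    {k : Type*} [Field k] [IsAlgClosed k] [CharZero k]
    (p : ℕ) {m n : ℕ} (hmn : m ≤ n)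
    (A : Matrix (Fin m) (Fin n) (MvPowerSeries (Fin p) k))
    (hA : ∀ i j, A i j ∈ maximalIdeal (MvPowerSeries (Fin p) k))
    (hsupp : ∃ N : ℕ, (maximalIdeal (MvPowerSeries (Fin p) k)) ^ N ≤ fittingIdeal m A) :
    ∃ (U : Matrix (Fin m) (Fin m) (MvPowerSeries (Fin p) k))
      (V : Matrix (Fin n) (Fin n) (MvPowerSeries (Fin p) k)),
      IsUnit U ∧ IsUnit V ∧
      ∀ i j, ∃ q : MvPolynomial (Fin p) k,
        (U * A * V) i j = (q : MvPowerSeries (Fin p) k) := by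
  obtain ⟨N, hN⟩ := hsupp
  have hX : ∀ i, (MvPowerSeries.X i : MvPowerSeries (Fin p) k) ∈ maximalIdeal _ := fun i => by
    simp [mem_maximalIdeal, mem_nonunits_iff, MvPowerSeries.isUnit_iff_constantCoeff]
  let T (i : Fin m) (j : Fin n) : MvPolynomial (Fin p) k :=
    MvPowerSeries.truncTotal (N + 1) (A i j)
  let B : Matrix (Fin m) (Fin n) (MvPowerSeries (Fin p) k) :=
    Matrix.of fun i j => (T i j : MvPowerSeries (Fin p) k) - A i j
  obtain ⟨C, hCI, hC⟩ := exists_mul_eq_of_mem_mul_fittingIdeal (A := A) (B := B)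
    (I := maximalIdeal _) fun i j => by
      refine Ideal.mul_mono_right hN ?_
      rw [← pow_succ']
      refine MvPowerSeries.mem_pow_of_coeff_eq_zero hX fun d hd => ?_
      simp [B, T, MvPowerSeries.coeff_truncTotal _ hd]
  refine ⟨1, 1 + C, isUnit_one, Matrix.isUnit_one_add_of_mem_maximalIdeal hCI,
    fun i j => ⟨T i j, ?_⟩⟩
  rw [Matrix.one_mul, Matrix.mul_add, Matrix.mul_one, hC]
  simp [B]
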